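/- Let p be a positive integer and let Φ : ℕ → Matrix n n ℂ satisfy Φ 0 = I, Φ t invertible for every t, and Φ (t+p) = Φ t · Φ p for all t ∈ ℕ. Then there exist an invertible matrix S : Matrix n n ℂ and a map L : ℕ → Matrix n n ℂ such that L (t+p) = L t for all t, L t is invertible for every t, and Φ t = L t · S^t for all t ∈ ℕ (discrete Floquet decomposition). -/

import Mathlib

open Matrix

open Polynomial in
/-- Over an algebraically closed field of characteristic zero, the class of `X` modulo a monic
polynomial that does not vanish at `0` has a `p`-th root. -/
theorem Polynomial.exists_dvd_pow_sub_X {K : Type*} [Field K] [IsAlgClosed K] [CharZero K]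
    {f : K[X]} (hf : f.Monic) (hf0 : f.coeff 0 ≠ 0) {p : ℕ} (hp : 0 < p) :
    ∃ q : K[X], f ∣ q ^ p - X := by
  classical
  choose r hr using fun a : K => IsAlgClosed.exists_pow_nat_eq a hp
  obtain ⟨q, hq⟩ : ∃ q : K[X], ∀ a ∈ f.roots, q.eval a = r a :=
    ⟨Lagrange.interpolate f.roots.toFinset (fun a => a) r, fun a ha =>
      Lagrange.eval_interpolate_at_node (v := fun a => a) r (Set.injOn_id _)
        (Multiset.mem_toFinset.2 ha)⟩
  have hqa (a : K) (ha : a ∈ f.roots) : (X - C a) ∣ q ^ p - X := by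
    rw [dvd_iff_isRoot, IsRoot.def, eval_sub, eval_pow, eval_X, hq a ha, hr, sub_self]
  have hdvd : f ∣ (q ^ p - X) ^ Multiset.card f.roots := by
    conv_lhs => rw [(IsAlgClosed.splits f).eq_prod_roots_of_monic hf]
    have := Multiset.prod_dvd_prod_of_dvd (S := f.roots) (fun a => X - C a)
      (fun _ => q ^ p - X) hqa
    simpa using this
  have hnil : IsNilpotent (AdjoinRoot.mk f q ^ p - AdjoinRoot.root f) :=
    ⟨_, by simpa using AdjoinRoot.mk_eq_zero.2 hdvd⟩
  have hroot : IsUnit (AdjoinRoot.root f) := by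
    obtain ⟨a, b, hab⟩ : IsCoprime X f :=
      (irreducible_X.coprime_iff_not_dvd).2 (by rwa [X_dvd_iff])
    refine IsUnit.of_mul_eq_one (AdjoinRoot.mk f a) ?_
    simpa [mul_comm] using congrArg (AdjoinRoot.mk f) hab
  have hunit : IsUnit (AdjoinRoot.mk f q) := by
    rw [← isUnit_pow_iff hp.ne', ← sub_add_cancel (AdjoinRoot.mk f q ^ p) (AdjoinRoot.root f)]
    exact hnil.isUnit_add_right_of_commute hroot (Commute.all _ _)
  have hpunit : IsUnit (p : AdjoinRoot f) := by
    have : IsUnit (p : K) := isUnit_iff_ne_zero.2 (Nat.cast_ne_zero.2 hp.ne')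
    simpa using this.map (algebraMap K (AdjoinRoot f))
  obtain ⟨y, ⟨-, hy⟩, -⟩ := existsUnique_nilpotent_sub_and_aeval_eq_zero
    (P := (X ^ p - C (AdjoinRoot.root f) : (AdjoinRoot f)[X])) (x := AdjoinRoot.mk f q)
    (by simpa using hnil) (by simpa [derivative_X_pow] using And.intro hpunit (hunit.pow (p - 1)))
  obtain ⟨s, rfl⟩ := AdjoinRoot.mk_surjective y
  exact ⟨s, AdjoinRoot.mk_eq_zero.1 (by simpa using hy)⟩

/-- An invertible matrix over an algebraically closed field of characteristic zero has a
`p`-th root. -/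
theorem Matrix.exists_pow_eq_of_isUnit_det {ι K : Type*} [Fintype ι] [DecidableEq ι] [Field K]
    [IsAlgClosed K] [CharZero K] {M : Matrix ι ι K} (hM : IsUnit M.det) {p : ℕ} (hp : 0 < p) :
    ∃ S : Matrix ι ι K, S ^ p = M := by
  have h0 : M.charpoly.coeff 0 ≠ 0 := fun h => hM.ne_zero <| by
    rw [M.det_eq_sign_charpoly_coeff, h, mul_zero]
  obtain ⟨q, g, hg⟩ := Polynomial.exists_dvd_pow_sub_X M.charpoly_monic h0 hp
  refine ⟨Polynomial.aeval M q, sub_eq_zero.1 ?_⟩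
  simpa [M.aeval_self_charpoly] using congrArg (Polynomial.aeval M) hg

/-- Discrete Floquet decomposition: if `Φ 0 = I`, each `Φ t` is invertible, and
`Φ (t+p) = Φ t · Φ p`, then `Φ t = L t · S^t` with `L` `p`-periodic and
everywhere invertible, and `S` a constant invertible matrix. -/
theorem stmt16 (n : ℕ) (p : ℕ) (hp : 0 < p) (Φ : ℕ → Matrix (Fin n) (Fin n) ℂ)
    (h0 : Φ 0 = 1) (hinv : ∀ t, IsUnit (Φ t).det)
    (hper : ∀ t, Φ (t + p) = Φ t * Φ p) :
    ∃ (S : Matrix (Fin n) (Fin n) ℂ) (L : ℕ → Matrix (Fin n) (Fin n) ℂ),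
      IsUnit S.det ∧ (∀ t, L (t + p) = L t) ∧ (∀ t, IsUnit (L t).det) ∧
      ∀ t, Φ t = L t * S ^ t := by
  obtain ⟨S, hS⟩ := Matrix.exists_pow_eq_of_isUnit_det (hinv p) hp
  have hdet : IsUnit S.det := by
    rw [← isUnit_pow_iff hp.ne', ← det_pow, hS]
    exact hinv p
  have hpow (t : ℕ) : IsUnit (S ^ t).det := by
    rw [det_pow]
    exact hdet.pow t
  refine ⟨S, fun t => Φ t * (S ^ t)⁻¹, hdet, fun t => ?_, fun t => ?_, fun t => ?_⟩
  · simp only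
    rw [hper, pow_add, Matrix.mul_inv_rev, hS, mul_assoc,
      mul_nonsing_inv_cancel_left _ _ (hinv p)]
  · rw [det_mul]
    exact (hinv t).mul ((isUnit_nonsing_inv_det_iff).2 (hpow t))
  · rw [nonsing_inv_mul_cancel_right _ _ (hpow t)]
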